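/- Sum of exterior angles bound: Let K ⊂ ℝ² be a compact convex body and γ = ∂K its boundary. For P ∈ γ define the inner angle α_P ∈ (0, π] as the supremum of ∠APB over A, B ∈ γ \ {P}, and the complementary angle α_P^c = π − α_P. Then for any finite set S of points of γ, Σ_{P ∈ S} α_P^c ≤ 2π. In particular, for any ε > 0 there are at most finitely many points P ∈ γ with α_P ≤ π − ε, and at most countably many singular points (points with α_P < π). -/

import Mathlib

open scoped BigOperators

/-- The inner angle of the convex body `K` at a boundary point `p`: the supremum of the angles
`∠ApB` over points `A, B` of the boundary distinct from `p`. -/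
noncomputable def innerAngle (K : Set (EuclideanSpace ℝ (Fin 2)))
    (p : EuclideanSpace ℝ (Fin 2)) : ℝ :=
  sSup {θ | ∃ A ∈ frontier K, ∃ B ∈ frontier K,
    A ≠ p ∧ B ≠ p ∧ θ = EuclideanGeometry.angle A p B}

/-- The unit vector of the Euclidean plane with polar angle `φ`. -/
noncomputable def unitVec (φ : ℝ) : EuclideanSpace ℝ (Fin 2) :=
  !₂[Real.cos φ, Real.sin φ]

theorem inner_unitVec (φ : ℝ) (v : EuclideanSpace ℝ (Fin 2)) :
    inner ℝ (unitVec φ) v = Real.cos φ * v 0 + Real.sin φ * v 1 := by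
  simp [unitVec, PiLp.inner_apply, Fin.sum_univ_two, mul_comm]

theorem inner_unitVec_unitVec (φ ψ : ℝ) :
    inner ℝ (unitVec φ) (unitVec ψ) = Real.cos (φ - ψ) := by
  rw [inner_unitVec, Real.cos_sub]
  simp [unitVec]

/-- Polar coordinates, with polar angle within `π / 2` of `t`, for a vector of the half-plane
`{v | 0 ≤ ⟪unitVec t, v⟫}`. -/
theorem exists_polar_of_inner_nonneg {t : ℝ} {v : EuclideanSpace ℝ (Fin 2)}
    (h : 0 ≤ inner ℝ (unitVec t) v) :
    ∃ s, |s - t| ≤ Real.pi / 2 ∧ v = ‖v‖ • unitVec s := by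
  rw [inner_unitVec] at h
  set w : ℂ := ⟨Real.cos t * v 0 + Real.sin t * v 1, Real.cos t * v 1 - Real.sin t * v 0⟩ with hw
  have hnorm : ‖w‖ = ‖v‖ := by
    rw [Complex.norm_eq_sqrt_sq_add_sq, EuclideanSpace.norm_eq, Fin.sum_univ_two]
    simp only [hw, Real.norm_eq_abs, sq_abs]
    congr 1
    linear_combination (v 0 ^ 2 + v 1 ^ 2) * Real.sin_sq_add_cos_sq t
  have hre : ‖v‖ * Real.cos w.arg = Real.cos t * v 0 + Real.sin t * v 1 := by
    rw [← hnorm, Complex.norm_mul_cos_arg]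
  have him : ‖v‖ * Real.sin w.arg = Real.cos t * v 1 - Real.sin t * v 0 := by
    rw [← hnorm, Complex.norm_mul_sin_arg]
  refine ⟨w.arg + t, ?_, ?_⟩
  · rw [add_sub_cancel_right]
    exact Complex.abs_arg_le_pi_div_two_iff.2 h
  · ext i
    fin_cases i
    · simp only [unitVec, Real.cos_add, PiLp.smul_apply, smul_eq_mul, Fin.zero_eta,
        Matrix.cons_val_zero]
      linear_combination -Real.cos t * hre + Real.sin t * him -
        v 0 * Real.sin_sq_add_cos_sq t
    · simp only [unitVec, Real.sin_add, PiLp.smul_apply, smul_eq_mul, Fin.mk_one,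
        Matrix.cons_val_one, Matrix.cons_val_zero]
      linear_combination -Real.sin t * hre - Real.cos t * him -
        v 1 * Real.sin_sq_add_cos_sq t

theorem angle_smul_unitVec {r r' s s' : ℝ} (hr : 0 < r) (hr' : 0 < r') (h : |s - s'| ≤ Real.pi) :
    InnerProductGeometry.angle (r • unitVec s) (r' • unitVec s') = |s - s'| := by
  have hnorm (φ : ℝ) : ‖unitVec φ‖ = 1 := by
    rw [norm_eq_sqrt_real_inner, inner_unitVec_unitVec]
    simp
  rw [InnerProductGeometry.angle_smul_left_of_pos _ _ hr,
    InnerProductGeometry.angle_smul_right_of_pos _ _ hr', InnerProductGeometry.angle,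
    inner_unitVec_unitVec, hnorm, hnorm, mul_one, div_one, ← Real.cos_abs,
    Real.arccos_cos (abs_nonneg _) h]

theorem innerAngle_nonneg (K : Set (EuclideanSpace ℝ (Fin 2))) (p : EuclideanSpace ℝ (Fin 2)) :
    0 ≤ innerAngle K p := by
  refine Real.sSup_nonneg ?_
  rintro _ ⟨A, -, B, -, -, -, rfl⟩
  exact EuclideanGeometry.angle_nonneg _ _ _

theorem angle_le_innerAngle {K : Set (EuclideanSpace ℝ (Fin 2))}
    {A B p : EuclideanSpace ℝ (Fin 2)} (hA : A ∈ frontier K) (hB : B ∈ frontier K)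
    (hAp : A ≠ p) (hBp : B ≠ p) : EuclideanGeometry.angle A p B ≤ innerAngle K p := by
  refine le_csSup ⟨Real.pi, ?_⟩ ⟨A, hA, B, hB, hAp, hBp, rfl⟩
  rintro _ ⟨A, -, B, -, -, -, rfl⟩
  exact EuclideanGeometry.angle_le_pi _ _ _

/-- A convex body of the plane has an inner normal direction at each boundary point. -/
theorem exists_inner_normal {K : Set (EuclideanSpace ℝ (Fin 2))}
    (hconv : Convex ℝ K) (hint : (interior K).Nonempty)
    {p : EuclideanSpace ℝ (Fin 2)} (hp : p ∈ frontier K) :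
    ∃ t, ∀ q ∈ frontier K, 0 ≤ inner ℝ (unitVec t) (q - p) := by
  obtain ⟨f, hf⟩ := geometric_hahn_banach_open_point hconv.interior isOpen_interior hp.2
  have hle (q) (hq : q ∈ frontier K) : f q ≤ f p := by
    have hq' : q ∈ closure (interior K) := by
      rw [hconv.closure_interior_eq_closure_of_nonempty_interior hint]
      exact hq.1
    exact closure_minimal (fun a ha => (hf a ha).le)
      (isClosed_le f.continuous continuous_const) hq'
  set n := (InnerProductSpace.toDual ℝ (EuclideanSpace ℝ (Fin 2))).symm (-f) with hn
  have hinner (v) : inner ℝ n v = -f v := by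
    rw [hn, InnerProductSpace.toDual_symm_apply, neg_apply]
  obtain ⟨a, ha⟩ := hint
  have hn0 : n ≠ 0 := by
    intro h0
    have h1 := hinner a
    have h2 := hinner p
    have := hf a ha
    simp only [h0, inner_zero_left] at h1 h2
    linarith
  obtain ⟨t, ht⟩ : ∃ t, n = ‖n‖ • unitVec t := by
    rcases le_total 0 (inner ℝ (unitVec 0) n) with h | h
    · obtain ⟨s, -, hs⟩ := exists_polar_of_inner_nonneg h
      exact ⟨s, hs⟩
    · have h' : 0 ≤ inner ℝ (unitVec Real.pi) n := by
        rw [inner_unitVec] at h ⊢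
        simpa using h
      obtain ⟨s, -, hs⟩ := exists_polar_of_inner_nonneg h'
      exact ⟨s, hs⟩
  refine ⟨t, fun q hq => ?_⟩
  have h1 : 0 ≤ inner ℝ n (q - p) := by
    rw [hinner, map_sub]
    linarith [hle q hq]
  rw [ht, real_inner_smul_left] at h1
  exact nonneg_of_mul_nonneg_right h1 (norm_pos_iff.2 hn0)

/-- The polar angles of the directions in which `p` is the strict maximizer over `S`. -/
def normalAngles (S : Finset (EuclideanSpace ℝ (Fin 2))) (p : EuclideanSpace ℝ (Fin 2)) : Set ℝ :=
  {φ | ∀ q ∈ S, q ≠ p → inner ℝ (unitVec φ) (q - p) < 0}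

theorem measurableSet_normalAngles (S : Finset (EuclideanSpace ℝ (Fin 2)))
    (p : EuclideanSpace ℝ (Fin 2)) : MeasurableSet (normalAngles S p) := by
  have : normalAngles S p =
      ⋂ q ∈ S, {φ | q ≠ p → inner ℝ (unitVec φ) (q - p) < 0} := by
    ext φ
    simp [normalAngles]
  rw [this]
  refine S.measurableSet_biInter fun q _ => ?_
  by_cases hq : q = p
  · simp [hq]
  · simp only [ne_eq, hq, not_false_eq_true, forall_const, inner_unitVec]
    exact measurableSet_lt (by fun_prop) measurable_const

theorem periodic_indicator_normalAngles (S : Finset (EuclideanSpace ℝ (Fin 2)))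
    (p : EuclideanSpace ℝ (Fin 2)) :
    Function.Periodic ((normalAngles S p).indicator (1 : ℝ → ℝ)) (2 * Real.pi) := by
  intro φ
  have : φ + 2 * Real.pi ∈ normalAngles S p ↔ φ ∈ normalAngles S p := by
    simp [normalAngles, unitVec]
  by_cases h : φ ∈ normalAngles S p <;> simp [Set.indicator, this, h]

theorem intervalIntegrable_indicator_normalAngles (S : Finset (EuclideanSpace ℝ (Fin 2)))
    (p : EuclideanSpace ℝ (Fin 2)) (a b : ℝ) :
    IntervalIntegrable ((normalAngles S p).indicator (1 : ℝ → ℝ)) MeasureTheory.volume a b := by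
  have h : IntervalIntegrable (1 : ℝ → ℝ) MeasureTheory.volume a b :=
    intervalIntegrable_const (c := (1 : ℝ))
  exact ⟨h.1.indicator (measurableSet_normalAngles S p),
    h.2.indicator (measurableSet_normalAngles S p)⟩

/-- The angles of normals at `p` contain an interval as long as the complementary angle. -/
theorem exists_Ioo_subset_normalAngles {K : Set (EuclideanSpace ℝ (Fin 2))}
    (hconv : Convex ℝ K) (hint : (interior K).Nonempty)
    {S : Finset (EuclideanSpace ℝ (Fin 2))}
    (hS : (S : Set (EuclideanSpace ℝ (Fin 2))) ⊆ frontier K)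
    {p : EuclideanSpace ℝ (Fin 2)} (hp : p ∈ S) :
    ∃ c d, Real.pi - innerAngle K p ≤ d - c ∧ c ≤ d ∧ d ≤ c + 2 * Real.pi ∧
      Set.Ioo c d ⊆ normalAngles S p := by
  classical
  obtain ⟨t, ht⟩ := exists_inner_normal hconv hint (hS hp)
  have hpi := Real.pi_pos
  have hpolar (q : EuclideanSpace ℝ (Fin 2)) :
      ∃ s, q ∈ S → |s - t| ≤ Real.pi / 2 ∧ q - p = ‖q - p‖ • unitVec s := by
    by_cases hq : q ∈ S
    · obtain ⟨s, hs⟩ := exists_polar_of_inner_nonneg (ht q (hS hq))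
      exact ⟨s, fun _ => hs⟩
    · exact ⟨0, fun h => (hq h).elim⟩
  choose s hs using hpolar
  rcases (S.erase p).eq_empty_or_nonempty with hemp | hne
  · refine ⟨0, Real.pi, by linarith [innerAngle_nonneg K p], hpi.le, by linarith, ?_⟩
    intro φ _ q hq hqp
    simpa [hemp] using Finset.mem_erase.2 ⟨hqp, hq⟩
  obtain ⟨A, hA, hAmin⟩ := (S.erase p).exists_min_image s hne
  obtain ⟨B, hB, hBmax⟩ := (S.erase p).exists_max_image s hne
  rw [Finset.mem_erase] at hA hB
  obtain ⟨hA1, hA2⟩ := hs A hA.2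
  obtain ⟨hB1, hB2⟩ := hs B hB.2
  have hAB : |s B - s A| ≤ Real.pi := by
    rw [abs_le] at *
    constructor <;> linarith
  have hangle : s B - s A ≤ innerAngle K p := by
    refine le_trans (le_abs_self _) ?_
    rw [← angle_smul_unitVec (norm_pos_iff.2 (sub_ne_zero.2 hB.1))
      (norm_pos_iff.2 (sub_ne_zero.2 hA.1)) hAB, ← hA2, ← hB2]
    exact angle_le_innerAngle (hS hB.2) (hS hA.2) hB.1 hA.1
  have hle := hAmin B (Finset.mem_erase.2 hB)
  have hAB' := (abs_le.1 hAB).2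
  refine ⟨s B + Real.pi / 2, s A + Real.pi + Real.pi / 2, by linarith, by linarith, by linarith,
    ?_⟩
  rintro φ ⟨h1, h2⟩ q hq hqp
  have hq' := Finset.mem_erase.2 ⟨hqp, hq⟩
  rw [(hs q hq).2, real_inner_smul_right, inner_unitVec_unitVec]
  refine mul_neg_of_pos_of_neg (norm_pos_iff.2 (sub_ne_zero.2 hqp))
    (Real.cos_neg_of_pi_div_two_lt_of_lt ?_ ?_)
  · linarith [hBmax q hq']
  · linarith [hAmin q hq']

theorem pi_sub_innerAngle_le_integral {K : Set (EuclideanSpace ℝ (Fin 2))}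
    (hconv : Convex ℝ K) (hint : (interior K).Nonempty)
    {S : Finset (EuclideanSpace ℝ (Fin 2))}
    (hS : (S : Set (EuclideanSpace ℝ (Fin 2))) ⊆ frontier K)
    {p : EuclideanSpace ℝ (Fin 2)} (hp : p ∈ S) :
    Real.pi - innerAngle K p ≤
      ∫ φ in (0 : ℝ)..(2 * Real.pi), (normalAngles S p).indicator (1 : ℝ → ℝ) φ := by
  obtain ⟨c, d, hlen, hcd, hd, hsub⟩ := exists_Ioo_subset_normalAngles hconv hint hS hp
  have hper := (periodic_indicator_normalAngles S p).intervalIntegral_add_eq 0 c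
  rw [zero_add] at hper
  rw [hper]
  calc Real.pi - innerAngle K p ≤ d - c := hlen
    _ = ∫ _ in c..d, (1 : ℝ) := by simp
    _ = ∫ φ in c..d, (normalAngles S p).indicator (1 : ℝ → ℝ) φ := by
        rw [intervalIntegral.integral_of_le hcd, intervalIntegral.integral_of_le hcd,
          MeasureTheory.integral_Ioc_eq_integral_Ioo, MeasureTheory.integral_Ioc_eq_integral_Ioo]
        refine MeasureTheory.setIntegral_congr_fun measurableSet_Ioo fun φ hφ => ?_
        simp [Set.indicator_of_mem (hsub hφ)]
    _ ≤ ∫ φ in c..(c + 2 * Real.pi), (normalAngles S p).indicator (1 : ℝ → ℝ) φ :=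
        intervalIntegral.integral_mono_interval le_rfl hcd hd
          (Filter.Eventually.of_forall fun φ =>
            Set.indicator_nonneg (fun _ _ => zero_le_one) φ)
          (intervalIntegrable_indicator_normalAngles S p _ _)

theorem sum_indicator_normalAngles_le_one (S : Finset (EuclideanSpace ℝ (Fin 2))) (φ : ℝ) :
    ∑ p ∈ S, (normalAngles S p).indicator (1 : ℝ → ℝ) φ ≤ 1 := by
  by_cases h : ∃ p ∈ S, φ ∈ normalAngles S p
  · obtain ⟨p, hp, hφ⟩ := h
    rw [Finset.sum_eq_single_of_mem p hp fun q hq hqp => Set.indicator_of_notMem (fun hφ' => ?_) _]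
    · simp [Set.indicator_of_mem hφ]
    · have h1 := hφ q hq hqp
      have h2 := hφ' p hp hqp.symm
      rw [inner_sub_right] at h1 h2
      linarith
  · push Not at h
    rw [Finset.sum_eq_zero fun p hp => Set.indicator_of_notMem (h p hp) _]
    exact zero_le_one

theorem sum_pi_sub_innerAngle_le {K : Set (EuclideanSpace ℝ (Fin 2))}
    (hconv : Convex ℝ K) (hint : (interior K).Nonempty)
    (S : Finset (EuclideanSpace ℝ (Fin 2)))
    (hS : (S : Set (EuclideanSpace ℝ (Fin 2))) ⊆ frontier K) :
    ∑ p ∈ S, (Real.pi - innerAngle K p) ≤ 2 * Real.pi := by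
  calc ∑ p ∈ S, (Real.pi - innerAngle K p)
      ≤ ∑ p ∈ S, ∫ φ in (0 : ℝ)..(2 * Real.pi), (normalAngles S p).indicator (1 : ℝ → ℝ) φ :=
        Finset.sum_le_sum fun p hp => pi_sub_innerAngle_le_integral hconv hint hS hp
    _ = ∫ φ in (0 : ℝ)..(2 * Real.pi),
          ∑ p ∈ S, (normalAngles S p).indicator (1 : ℝ → ℝ) φ :=
        (intervalIntegral.integral_finsetSum fun p _ =>
          intervalIntegrable_indicator_normalAngles S p _ _).symm
    _ ≤ ∫ _ in (0 : ℝ)..(2 * Real.pi), (1 : ℝ) := by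
        refine intervalIntegral.integral_mono_on Real.two_pi_pos.le ?_
          intervalIntegrable_const fun φ _ => sum_indicator_normalAngles_le_one S φ
        simpa only [Finset.sum_fn] using IntervalIntegrable.sum S fun p _ =>
          intervalIntegrable_indicator_normalAngles S p 0 (2 * Real.pi)
    _ = 2 * Real.pi := by simp

theorem finite_innerAngle_le {K : Set (EuclideanSpace ℝ (Fin 2))}
    (hconv : Convex ℝ K) (hint : (interior K).Nonempty) {ε : ℝ} (hε : 0 < ε) :
    {p | p ∈ frontier K ∧ innerAngle K p ≤ Real.pi - ε}.Finite := by
  by_contra hinf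
  obtain ⟨n, hn⟩ := exists_nat_gt (2 * Real.pi / ε)
  obtain ⟨S, hS, hcard⟩ := Set.Infinite.exists_subset_card_eq hinf n
  have h1 := sum_pi_sub_innerAngle_le hconv hint S fun p hp => (hS hp).1
  have h2 : S.card • ε ≤ ∑ p ∈ S, (Real.pi - innerAngle K p) :=
    Finset.card_nsmul_le_sum _ _ _ fun p hp => by linarith [(hS hp).2]
  rw [hcard, nsmul_eq_mul] at h2
  rw [div_lt_iff₀ hε] at hn
  linarith

/-- Sum of exterior angles bound: Let `K ⊂ ℝ²` be a compact convex body with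
boundary `γ = ∂K`.  With `α_P` the inner angle at `P ∈ γ` and `α_P^c = π − α_P`, one has
`Σ_{P ∈ S} α_P^c ≤ 2π` for every finite `S ⊆ γ`.  In particular, for every `ε > 0` only
finitely many boundary points have `α_P ≤ π − ε`, and there are at most countably many
singular points (`α_P < π`). -/
theorem stmt17 (K : Set (EuclideanSpace ℝ (Fin 2)))
    (hcomp : IsCompact K) (hconv : Convex ℝ K) (hint : (interior K).Nonempty) :
    (∀ S : Finset (EuclideanSpace ℝ (Fin 2)), (↑S : Set (EuclideanSpace ℝ (Fin 2))) ⊆ frontier K →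
        ∑ p ∈ S, (Real.pi - innerAngle K p) ≤ 2 * Real.pi) ∧
      (∀ ε > (0 : ℝ), {p | p ∈ frontier K ∧ innerAngle K p ≤ Real.pi - ε}.Finite) ∧
      {p | p ∈ frontier K ∧ innerAngle K p < Real.pi}.Countable := by
  refine ⟨sum_pi_sub_innerAngle_le hconv hint, fun ε hε => finite_innerAngle_le hconv hint hε, ?_⟩
  refine (Set.countable_iUnion fun n : ℕ => (finite_innerAngle_le hconv hint
    (Nat.one_div_pos_of_nat (α := ℝ) (n := n))).countable).mono ?_
  rintro p ⟨hp, hlt⟩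
  obtain ⟨n, hn⟩ := exists_nat_one_div_lt (sub_pos.2 hlt)
  exact Set.mem_iUnion.2 ⟨n, hp, by linarith⟩
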